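/- For every y ∈ X_d (a difference of symmetric probability measures), H(y ⊠ y) ≤ 0, with equality if and only if y = 0. -/

import Mathlib

open MeasureTheory Real Filter Topology Polynomial

noncomputable section

/-- The space of finite signed Borel measures on the extended reals `ℝ̄`. -/
abbrev SM := MeasureTheory.SignedMeasure EReal

namespace SCLDPC

/-- The weight `e^{-α/2}` as an extended nonnegative real (`+∞` at `α = -∞`). -/
def wt (α : EReal) : ENNReal :=
  if α = ⊥ then ⊤ else if α = ⊤ then 0 else ENNReal.ofReal (Real.exp (-(α.toReal) / 2))

/-- A (nonnegative) Borel measure `μ` on `ℝ̄` is symmetric if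
`∫_{-E} e^{-α/2} μ(dα) = ∫_{E} e^{-α/2} μ(dα)` for every Borel set `E`
(stated with extended nonnegative integrals, which is equivalent to requiring
equality whenever one of the two sides is finite). -/
def IsSymmMeasure (μ : Measure EReal) : Prop :=
  ∀ E : Set EReal, MeasurableSet E →
    ∫⁻ α in (fun a : EReal => -a) ⁻¹' E, wt α ∂μ = ∫⁻ α in E, wt α ∂μ

/-- Positive part of the Jordan decomposition. -/
def jp (x : SM) : Measure EReal := x.toJordanDecomposition.posPart

/-- Negative part of the Jordan decomposition. -/
def jn (x : SM) : Measure EReal := x.toJordanDecomposition.negPart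

instance (x : SM) : IsFiniteMeasure (jp x) := x.toJordanDecomposition.posPart_finite

instance (x : SM) : IsFiniteMeasure (jn x) := x.toJordanDecomposition.negPart_finite

/-- A finite signed Borel measure on `ℝ̄` is symmetric iff both parts of its Jordan
decomposition are symmetric measures. -/
def IsSymm (x : SM) : Prop := IsSymmMeasure (jp x) ∧ IsSymmMeasure (jn x)

/-- Membership in `X`, the set of symmetric probability measures on `ℝ̄`. -/
def MemX (x : SM) : Prop :=
  (∃ (μ : Measure EReal) (hμ : IsProbabilityMeasure μ),
      x = (letI := hμ; μ.toSignedMeasure)) ∧ IsSymm x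

/-- Membership in `X_d`, the set of differences of symmetric probability measures. -/
def MemXd (y : SM) : Prop := ∃ x1 x2 : SM, MemX x1 ∧ MemX x2 ∧ y = x1 - x2

/-- Integral of a real function against a finite signed measure. -/
def sInt (f : EReal → ℝ) (x : SM) : ℝ := (∫ α, f α ∂(jp x)) - ∫ α, f α ∂(jn x)

/-- `tanh(α/2)` extended continuously to `ℝ̄`. -/
def tanhHalf (α : EReal) : ℝ :=
  if α = ⊤ then 1 else if α = ⊥ then -1 else Real.tanh (α.toReal / 2)

/-- The inverse hyperbolic tangent on `(-1, 1)`. -/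
def artanh (t : ℝ) : ℝ := Real.log ((1 + t) / (1 - t)) / 2

/-- `2 tanh⁻¹(t)` valued in `ℝ̄` (sending `t ≥ 1` to `+∞` and `t ≤ -1` to `-∞`). -/
def atanhTwo (t : ℝ) : EReal :=
  if 1 ≤ t then ⊤ else if t ≤ -1 then ⊥ else ((2 * artanh t : ℝ) : EReal)

/-- Variable-node convolution `⊛` of two (nonnegative) measures:
`(μ ⊛ ν)(E) = ∫ μ(E - α) ν(dα)`, i.e. the pushforward of `μ × ν` under addition. -/
def mConv (μ ν : Measure EReal) : Measure EReal :=
  (μ.prod ν).map fun p => p.1 + p.2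

/-- Check-node convolution `⊠` of two (nonnegative) measures:
`(μ ⊠ ν)(E) = ∫ μ(2 tanh⁻¹(tanh(E/2) / tanh(α/2))) ν(dα)`, where the argument of `μ`
is the image of `E` under `β ↦ 2 tanh⁻¹(tanh(β/2) / tanh(α/2))`; equivalently, the
pushforward of `μ × ν` under `(β, α) ↦ 2 tanh⁻¹(tanh(β/2) · tanh(α/2))`. -/
def mCheck (μ ν : Measure EReal) : Measure EReal :=
  (μ.prod ν).map fun p => atanhTwo (tanhHalf p.1 * tanhHalf p.2)

instance (μ ν : Measure EReal) [IsFiniteMeasure μ] [IsFiniteMeasure ν] :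
    IsFiniteMeasure (mConv μ ν) := by unfold mConv; infer_instance

instance (μ ν : Measure EReal) [IsFiniteMeasure μ] [IsFiniteMeasure ν] :
    IsFiniteMeasure (mCheck μ ν) := by unfold mCheck; infer_instance

/-- The variable-node operation `⊛` extended bilinearly to finite signed measures. -/
def sConv (x y : SM) : SM :=
  (mConv (jp x) (jp y)).toSignedMeasure - (mConv (jp x) (jn y)).toSignedMeasure
    - (mConv (jn x) (jp y)).toSignedMeasure + (mConv (jn x) (jn y)).toSignedMeasure

/-- The check-node operation `⊠` extended bilinearly to finite signed measures. -/
def sCheck (x y : SM) : SM :=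
  (mCheck (jp x) (jp y)).toSignedMeasure - (mCheck (jp x) (jn y)).toSignedMeasure
    - (mCheck (jn x) (jp y)).toSignedMeasure + (mCheck (jn x) (jn y)).toSignedMeasure

/-- The integrand `log₂(1 + e^{-α})` of the entropy functional (with the harmless
convention that it vanishes at `α = ±∞`; symmetric measures put no mass at `-∞`). -/
def entFn (α : EReal) : ℝ :=
  if α = ⊤ then 0 else if α = ⊥ then 0 else Real.logb 2 (1 + Real.exp (-(α.toReal)))

/-- The entropy functional `H(x) = ∫ log₂(1 + e^{-α}) x(dα)`. -/
def H (x : SM) : ℝ := sInt entFn x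

theorem measurable_tanhHalf : Measurable tanhHalf := by
  unfold tanhHalf
  have h : Measurable Real.tanh := by
    have : Real.tanh = fun x => Real.sinh x / Real.cosh x := by
      ext x; exact Real.tanh_eq_sinh_div_cosh x
    rw [this]
    exact Real.measurable_sinh.div Real.measurable_cosh
  refine Measurable.ite (measurableSet_singleton _) measurable_const ?_
  refine Measurable.ite (measurableSet_singleton _) measurable_const ?_
  exact h.comp (measurable_ereal_toReal.div_const 2)

theorem measurable_atanhTwo : Measurable atanhTwo := by
  unfold atanhTwo artanh
  refine Measurable.ite measurableSet_Ici measurable_const ?_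
  refine Measurable.ite measurableSet_Iic measurable_const ?_
  refine measurable_coe_real_ereal.comp ?_
  fun_prop

theorem measurable_entFn : Measurable entFn := by
  unfold entFn
  refine Measurable.ite (measurableSet_singleton _) measurable_const ?_
  refine Measurable.ite (measurableSet_singleton _) measurable_const ?_
  unfold Real.logb
  have := measurable_ereal_toReal
  fun_prop

theorem measurable_wt : Measurable wt := by
  unfold wt
  refine Measurable.ite (measurableSet_singleton _) measurable_const ?_
  refine Measurable.ite (measurableSet_singleton _) measurable_const ?_
  have := measurable_ereal_toReal
  fun_prop

theorem tanhHalf_coe (x : ℝ) : tanhHalf (x : EReal) = Real.tanh (x / 2) := by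
  simp [tanhHalf]

theorem tanhHalf_top : tanhHalf ⊤ = 1 := by simp [tanhHalf]

theorem tanhHalf_bot : tanhHalf ⊥ = -1 := by simp [tanhHalf]

theorem tanhHalf_le_one (a : EReal) : tanhHalf a ≤ 1 := by
  induction a with
  | bot => rw [tanhHalf_bot]; norm_num
  | top => rw [tanhHalf_top]
  | coe x => rw [tanhHalf_coe]; exact (Real.tanh_lt_one _).le

theorem neg_one_le_tanhHalf (a : EReal) : -1 ≤ tanhHalf a := by
  induction a with
  | bot => rw [tanhHalf_bot]
  | top => rw [tanhHalf_top]; norm_num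
  | coe x => rw [tanhHalf_coe]; exact (Real.neg_one_lt_tanh _).le

theorem neg_one_lt_tanhHalf {a : EReal} (h : a ≠ ⊥) : -1 < tanhHalf a := by
  induction a with
  | bot => exact absurd rfl h
  | top => rw [tanhHalf_top]; norm_num
  | coe x => rw [tanhHalf_coe]; exact (Real.neg_one_lt_tanh _)

theorem tanhHalf_neg (a : EReal) : tanhHalf (-a) = - tanhHalf a := by
  induction a with
  | bot => simp [tanhHalf_bot, tanhHalf_top]
  | top => simp [tanhHalf_bot, tanhHalf_top]
  | coe x => rw [← EReal.coe_neg, tanhHalf_coe, tanhHalf_coe, ← Real.tanh_neg]; ring_nf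

/-- `tanh(x/2)` in terms of `e^{-x}`. -/
theorem tanh_half_eq (x : ℝ) : Real.tanh (x / 2) = (1 - Real.exp (-x)) / (1 + Real.exp (-x)) := by
  rw [Real.tanh_eq]
  have h : Real.exp (-x) = Real.exp (-(x/2)) * Real.exp (-(x/2)) := by
    rw [← Real.exp_add]; ring_nf
  have h2 : Real.exp (x/2) * Real.exp (-(x/2)) = 1 := by
    rw [← Real.exp_add]; simp
  have h3 := Real.exp_pos (x/2)
  have h4 := Real.exp_pos (-(x/2))
  rw [h, div_eq_div_iff (by positivity) (by positivity)]
  linear_combination (2 * Real.exp (-(x/2))) * h2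

theorem atanhTwo_tanhHalf (a : EReal) : atanhTwo (tanhHalf a) = a := by
  induction a with
  | bot => rw [tanhHalf_bot]; norm_num [atanhTwo]
  | top => rw [tanhHalf_top]; norm_num [atanhTwo]
  | coe x =>
    rw [tanhHalf_coe]
    have h1 := Real.tanh_lt_one (x/2)
    have h2 := Real.neg_one_lt_tanh (x/2)
    unfold atanhTwo artanh
    rw [if_neg (not_le.2 h1), if_neg (not_le.2 h2)]
    congr 1
    have h3 := Real.exp_pos (-x)
    have : (1 + Real.tanh (x/2)) / (1 - Real.tanh (x/2)) = Real.exp x := by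
      rw [div_eq_iff (by linarith), tanh_half_eq]
      have h5 : Real.exp x * Real.exp (-x) = 1 := by rw [← Real.exp_add]; simp
      field_simp
      linear_combination (-2) * h5
    rw [this, Real.log_exp]; ring

theorem entFn_atanhTwo {s : ℝ} (h1 : -1 < s) (h2 : s ≤ 1) :
    entFn (atanhTwo s) = 1 - Real.log (1 + s) / Real.log 2 := by
  have hl : Real.log 2 ≠ 0 := (Real.log_pos (by norm_num)).ne'
  rcases h2.eq_or_lt with rfl | h2
  · simp [atanhTwo, entFn]
    norm_num [hl]
  · unfold atanhTwo artanh
    rw [if_neg (not_le.2 h2), if_neg (not_le.2 h1)]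
    simp only [entFn, EReal.coe_ne_top, EReal.coe_ne_bot, if_false, EReal.toReal_coe]
    have h3 : 0 < (1 + s) / (1 - s) := div_pos (by linarith) (by linarith)
    rw [mul_div_cancel₀ _ (two_ne_zero), Real.exp_neg, Real.exp_log h3]
    have : 1 + ((1 + s) / (1 - s))⁻¹ = 2 / (1 + s) := by
      have : 1 + s ≠ 0 := by linarith
      have : 1 - s ≠ 0 := by linarith
      field_simp; ring
    rw [this, Real.logb, Real.log_div (by norm_num) (by linarith)]
    field_simp

theorem wt_coe (x : ℝ) : wt (x : EReal) = ENNReal.ofReal (Real.exp (-x / 2)) := by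
  simp [wt]

theorem one_sub_tanhHalf {a : EReal} (h : a ≠ ⊥) :
    1 - tanhHalf a = (wt a).toReal * Real.sqrt (1 - tanhHalf a ^ 2) := by
  induction a with
  | bot => exact absurd rfl h
  | top => simp [tanhHalf_top]
  | coe x =>
    rw [tanhHalf_coe, wt_coe, ENNReal.toReal_ofReal (Real.exp_pos _).le, tanh_half_eq]
    have h : Real.exp (-x) = Real.exp (-x/2) * Real.exp (-x/2) := by
      rw [← Real.exp_add]; ring_nf
    have hp := Real.exp_pos (-x/2)
    have : Real.sqrt (1 - ((1 - Real.exp (-x)) / (1 + Real.exp (-x))) ^ 2)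
        = 2 * Real.exp (-x/2) / (1 + Real.exp (-x)) := by
      rw [Real.sqrt_eq_iff_mul_self_eq_of_pos (by positivity), h]
      field_simp
      ring
    rw [this, h]
    field_simp
    ring

theorem abs_log_le {a : EReal} (h : a ≠ ⊥) :
    |Real.log (1 + tanhHalf a)| ≤ 1 + 2 * (wt a).toReal := by
  have h0 := neg_one_lt_tanhHalf h
  have hw : 0 ≤ (wt a).toReal := ENNReal.toReal_nonneg
  rw [abs_le]
  constructor
  · induction a with
    | bot => exact absurd rfl h
    | top => rw [tanhHalf_top]; have := Real.log_pos (x := 1+1) (by norm_num); linarith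
    | coe x =>
      rw [wt_coe, ENNReal.toReal_ofReal (Real.exp_pos _).le] at hw ⊢
      rw [tanhHalf_coe, tanh_half_eq]
      have hp := Real.exp_pos (-x)
      have : 1 + (1 - Real.exp (-x)) / (1 + Real.exp (-x)) = 2 / (1 + Real.exp (-x)) := by
        field_simp; ring
      rw [this]
      have h3 := Real.add_one_le_exp (-x/2)
      rcases le_total 0 x with hx | hx
      · have : Real.exp (-x) ≤ 1 := Real.exp_le_one_iff.2 (by linarith)
        have : 0 ≤ Real.log (2 / (1 + Real.exp (-x))) :=
          Real.log_nonneg (by rw [le_div_iff₀ (by positivity)]; linarith)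
        linarith
      · have h1 : 1 ≤ Real.exp (-x) := Real.one_le_exp (by linarith)
        have : Real.log (Real.exp x) ≤ Real.log (2 / (1 + Real.exp (-x))) := by
          refine Real.log_le_log (Real.exp_pos _) ?_
          rw [le_div_iff₀ (by positivity)]
          have h5 : Real.exp x * Real.exp (-x) = 1 := by rw [← Real.exp_add]; simp
          have : Real.exp x ≤ 1 := Real.exp_le_one_iff.2 hx
          linarith
        rw [Real.log_exp] at this
        linarith
  · have := Real.log_le_sub_one_of_pos (x := 1 + tanhHalf a) (by linarith)
    have := tanhHalf_le_one a
    linarith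

theorem abs_log_mul_le {s t : ℝ} (hs : -1 < s) (hs' : s ≤ 1) (ht : -1 < t) (ht' : t ≤ 1) :
    |Real.log (1 + s * t)| ≤ 1 + |Real.log (1 + s)| + |Real.log (1 + t)| := by
  have e1 := abs_nonneg (Real.log (1 + s))
  have e2 := abs_nonneg (Real.log (1 + t))
  have aux : ∀ u v : ℝ, -1 < u → u ≤ 0 → 0 ≤ v → v ≤ 1 →
      |Real.log (1 + u * v)| ≤ |Real.log (1 + u)| := by
    intro u v h1 h2 h3 h4
    have : u ≤ u * v := by nlinarith
    have : u * v ≤ 0 := by nlinarith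
    rw [abs_of_nonpos (Real.log_nonpos (by linarith) (by linarith)),
      abs_of_nonpos (Real.log_nonpos (by linarith) (by linarith))]
    exact neg_le_neg (Real.log_le_log (by linarith) (by linarith))
  have aux2 : 0 ≤ s * t → |Real.log (1 + s * t)| ≤ 1 := by
    intro h
    rw [abs_of_nonneg (Real.log_nonneg (by linarith))]
    have := Real.log_le_sub_one_of_pos (x := 1 + s * t) (by linarith)
    nlinarith
  rcases le_total 0 s with h | h <;> rcases le_total 0 t with h' | h'
  · linarith [aux2 (mul_nonneg h h')]
  · have := aux t s ht h' h hs'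
    rw [mul_comm] at this; linarith
  · have := aux s t hs h h' ht'
    linarith
  · linarith [aux2 (mul_nonneg_of_nonpos_of_nonpos h h')]

theorem abs_log_r_le {r s : ℝ} (hr : 0 ≤ r) (hr' : r ≤ 1) (hs : -1 < s) :
    |Real.log (1 + r * s)| ≤ |Real.log (1 + s)| := by
  rcases le_total 0 s with h | h
  · have h1 : 0 ≤ r * s := mul_nonneg hr h
    have : r * s ≤ s := by nlinarith
    rw [abs_of_nonneg (Real.log_nonneg (by linarith)),
      abs_of_nonneg (Real.log_nonneg (by linarith))]
    exact (Real.log_le_log (by linarith) (by linarith))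
  · have : s ≤ r * s := by nlinarith
    have : r * s ≤ 0 := by nlinarith
    rw [abs_of_nonpos (Real.log_nonpos (by linarith) (by linarith)),
      abs_of_nonpos (Real.log_nonpos (by linarith) (by linarith))]
    exact neg_le_neg (Real.log_le_log (by linarith) (by linarith))

theorem jp_sub (a b : Measure EReal) [IsFiniteMeasure a] [IsFiniteMeasure b] :
    jp (a.toSignedMeasure - b.toSignedMeasure) = a - b := by
  simp [jp, Measure.jordanDecompositionOfToSignedMeasureSub_posPart]

theorem jn_sub (a b : Measure EReal) [IsFiniteMeasure a] [IsFiniteMeasure b] :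
    jn (a.toSignedMeasure - b.toSignedMeasure) = b - a := by
  simp [jn, Measure.jordanDecompositionOfToSignedMeasureSub_negPart]

theorem jp_toSigned (a : Measure EReal) [IsFiniteMeasure a] : jp a.toSignedMeasure = a := by
  have := jp_sub a 0
  simpa using this

theorem jp_sub_jn (y : SM) : (jp y).toSignedMeasure - (jn y).toSignedMeasure = y :=
  SignedMeasure.toSignedMeasure_toJordanDecomposition y

/-- The relation between the Jordan parts of a difference and the original measures. -/
theorem jp_add (a b : Measure EReal) [IsFiniteMeasure a] [IsFiniteMeasure b] (y : SM)
    (hy : y = a.toSignedMeasure - b.toSignedMeasure) : jp y + b = jn y + a := by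
  rw [← Measure.toSignedMeasure_eq_toSignedMeasure_iff, Measure.toSignedMeasure_add,
    Measure.toSignedMeasure_add]
  have := jp_sub_jn y
  rw [sub_eq_iff_eq_add] at this
  rw [this, hy]
  abel

theorem sInt_sub (f : EReal → ℝ) (a b : Measure EReal) [IsFiniteMeasure a] [IsFiniteMeasure b]
    (ha : Integrable f a) (hb : Integrable f b) (y : SM)
    (hy : y = a.toSignedMeasure - b.toSignedMeasure) :
    sInt f y = ∫ x, f x ∂a - ∫ x, f x ∂b := by
  have h := jp_add a b y hy
  have h1 : Integrable f (jp y) := ha.mono_measure (by rw [hy, jp_sub]; exact Measure.sub_le)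
  have h2 : Integrable f (jn y) := hb.mono_measure (by rw [hy, jn_sub]; exact Measure.sub_le)
  have h3 : ∫ x, f x ∂(jp y + b) = ∫ x, f x ∂(jn y + a) := by rw [h]
  rw [integral_add_measure h1 hb, integral_add_measure h2 ha] at h3
  unfold sInt
  linarith

/-- Moments of the law of `tanh(α/2)`. -/
def mom (a : Measure EReal) (k : ℕ) : ℝ := ∫ x, tanhHalf x ^ k ∂a

theorem abs_tanhHalf_le (x : EReal) : |tanhHalf x| ≤ 1 :=
  abs_le.2 ⟨neg_one_le_tanhHalf x, tanhHalf_le_one x⟩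

theorem integrable_pow (a : Measure EReal) [IsFiniteMeasure a] (k : ℕ) :
    Integrable (fun x => tanhHalf x ^ k) a := by
  refine Integrable.of_bound (C := 1) (measurable_tanhHalf.pow_const k).aestronglyMeasurable ?_
  refine ae_of_all _ fun x => ?_
  rw [Real.norm_eq_abs, abs_pow]
  exact pow_le_one₀ (abs_nonneg _) (abs_tanhHalf_le x)

/-- Integrability properties of symmetric measures, inherited by smaller measures. -/
def Good (a : Measure EReal) : Prop :=
  (∀ᵐ x ∂a, x ≠ ⊥) ∧ Integrable (fun x => |Real.log (1 + tanhHalf x)|) a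

theorem Good.mono {a b : Measure EReal} (h : Good b) (hab : a ≤ b) : Good a :=
  ⟨ae_mono hab h.1, h.2.mono_measure hab⟩

theorem lintegral_wt (a : Measure EReal) [IsFiniteMeasure a] (h : IsSymmMeasure a) :
    ∫⁻ x, wt x ∂a ≠ ⊤ := by
  have hb : ∀ s : Set EReal, MeasurableSet s → s ⊆ Set.Ici 0 → ∫⁻ x in s, wt x ∂a < ⊤ := by
    intro s hs hs'
    have : ∫⁻ x in s, wt x ∂a ≤ ∫⁻ x in s, 1 ∂a := by
      refine setLIntegral_mono measurable_const fun x hx => ?_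
      have hx := hs' hx
      induction x with
      | bot => simp at hx
      | top => simp [wt]
      | coe x =>
        rw [wt_coe]
        simp only [Set.mem_Ici, EReal.coe_nonneg] at hx
        rw [ENNReal.ofReal_le_one]
        exact Real.exp_le_one_iff.2 (by linarith)
    refine this.trans_lt ?_
    simp
  have h1 := hb (Set.Ici 0) measurableSet_Ici le_rfl
  have h2 := hb (Set.Ioi 0) measurableSet_Ioi Set.Ioi_subset_Ici_self
  have h3 : (fun a : EReal => -a) ⁻¹' (Set.Iio 0) = Set.Ioi 0 := by
    ext x; simp
  have h4 := h (Set.Iio 0) measurableSet_Iio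
  rw [h3] at h4
  rw [← lintegral_add_compl _ (measurableSet_Ici (a := (0 : EReal))), Set.compl_Ici, ← h4]
  exact (ENNReal.add_lt_top.2 ⟨h1, h2⟩).ne

theorem good_of_symm (a : Measure EReal) [IsFiniteMeasure a] (h : IsSymmMeasure a) : Good a := by
  have hw := lintegral_wt a h
  have h1 : ∀ᵐ x ∂a, x ≠ ⊥ := by
    filter_upwards [ae_lt_top measurable_wt hw] with x hx hx'
    simp [hx', wt] at hx
  refine ⟨h1, ?_⟩
  have hi := (integrable_toReal_of_lintegral_ne_top measurable_wt.aemeasurable hw)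
  refine Integrable.mono' ((integrable_const (1:ℝ)).add (hi.const_mul 2)) ?_ ?_
  · have := measurable_tanhHalf
    have : Measurable (fun x => |Real.log (1 + tanhHalf x)|) := by
      simp_rw [← Real.norm_eq_abs]; fun_prop
    exact this.aestronglyMeasurable
  · filter_upwards [h1] with x hx
    rw [Real.norm_eq_abs, abs_abs]
    exact abs_log_le hx

/-- Odd moments of a symmetric measure agree with the next even moments. -/
theorem mom_symm (a : Measure EReal) [IsFiniteMeasure a] (h : IsSymmMeasure a) (j : ℕ) :
    mom a (2 * j + 1) = mom a (2 * j + 2) := by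
  have hw := lintegral_wt a h
  have hg := good_of_symm a h
  set ρ := a.withDensity wt with hρ
  have hm : ρ.map (fun x => -x) = ρ := by
    ext E hE
    rw [Measure.map_apply measurable_neg hE, hρ, withDensity_apply _ hE,
      withDensity_apply _ (measurable_neg hE)]
    exact h E hE
  set φ : EReal → ℝ := fun x => tanhHalf x ^ (2 * j + 1) * Real.sqrt (1 - tanhHalf x ^ 2) with hφ
  have hφm : Measurable φ := by
    have := measurable_tanhHalf
    fun_prop
  have h1 : ∫ x, φ x ∂ρ = - ∫ x, φ x ∂ρ := by
    conv_lhs => rw [← hm]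
    rw [integral_map measurable_neg.aemeasurable hφm.aestronglyMeasurable, ← integral_neg]
    congr 1
    ext x
    simp only [hφ, tanhHalf_neg]
    rw [Odd.neg_pow ⟨j, rfl⟩, neg_sq]
    ring
  have h2 : ∫ x, φ x ∂ρ = 0 := by linarith
  rw [hρ, integral_withDensity_eq_integral_toReal_smul measurable_wt
    (ae_lt_top measurable_wt hw)] at h2
  have h3 : ∫ x, (tanhHalf x ^ (2 * j + 1) - tanhHalf x ^ (2 * j + 2)) ∂a = 0 := by
    rw [← h2]
    refine integral_congr_ae ?_
    filter_upwards [hg.1] with x hx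
    simp only [hφ, smul_eq_mul]
    have := one_sub_tanhHalf hx
    linear_combination (tanhHalf x ^ (2 * j + 1)) * this
  rw [integral_sub (integrable_pow a _) (integrable_pow a _)] at h3
  unfold mom
  linarith

theorem ae_prod_good {a b : Measure EReal} [IsFiniteMeasure a] [IsFiniteMeasure b]
    (ha : Good a) (hb : Good b) : ∀ᵐ z ∂(a.prod b), z.1 ≠ ⊥ ∧ z.2 ≠ ⊥ := by
  have h1 := Measure.quasiMeasurePreserving_fst (μ := a) (ν := b) |>.ae ha.1
  have h2 := Measure.quasiMeasurePreserving_snd (μ := a) (ν := b) |>.ae hb.1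
  filter_upwards [h1, h2] with z h1 h2 using ⟨h1, h2⟩

theorem mul_mem {z : EReal × EReal} (h : z.1 ≠ ⊥ ∧ z.2 ≠ ⊥) :
    -1 < tanhHalf z.1 * tanhHalf z.2 ∧ tanhHalf z.1 * tanhHalf z.2 ≤ 1 := by
  have h1 := neg_one_lt_tanhHalf h.1
  have h2 := neg_one_lt_tanhHalf h.2
  have h3 := tanhHalf_le_one z.1
  have h4 := tanhHalf_le_one z.2
  constructor
  · rcases le_total 0 (tanhHalf z.1) with h | h <;> nlinarith
  · rcases le_total 0 (tanhHalf z.1) with h | h <;> nlinarith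

/-- The regularised bilinear form. -/
def EE (a b : Measure EReal) (r : ℝ) : ℝ :=
  ∫ z, Real.log (1 + r * (tanhHalf z.1 * tanhHalf z.2)) ∂(a.prod b)

theorem measurable_EE (r : ℝ) : Measurable (fun z : EReal × EReal =>
    Real.log (1 + r * (tanhHalf z.1 * tanhHalf z.2))) := by
  have := measurable_tanhHalf
  fun_prop

theorem integrable_bound {a b : Measure EReal} [IsFiniteMeasure a] [IsFiniteMeasure b]
    (ha : Good a) (hb : Good b) : Integrable (fun z : EReal × EReal =>
      1 + |Real.log (1 + tanhHalf z.1)| + |Real.log (1 + tanhHalf z.2)|) (a.prod b) :=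
  ((integrable_const (1:ℝ)).add (ha.2.comp_fst b)).add (hb.2.comp_snd a)

theorem EE_bound {r : ℝ} (hr : 0 ≤ r) (hr' : r ≤ 1) {z : EReal × EReal}
    (h : z.1 ≠ ⊥ ∧ z.2 ≠ ⊥) : ‖Real.log (1 + r * (tanhHalf z.1 * tanhHalf z.2))‖ ≤
      1 + |Real.log (1 + tanhHalf z.1)| + |Real.log (1 + tanhHalf z.2)| := by
  rw [Real.norm_eq_abs]
  exact (abs_log_r_le hr hr' (mul_mem h).1).trans
    (abs_log_mul_le (neg_one_lt_tanhHalf h.1) (tanhHalf_le_one _)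
      (neg_one_lt_tanhHalf h.2) (tanhHalf_le_one _))

theorem EE_tendsto {a b : Measure EReal} [IsFiniteMeasure a] [IsFiniteMeasure b]
    (ha : Good a) (hb : Good b) : Tendsto (EE a b) (𝓝[<] 1) (𝓝 (EE a b 1)) := by
  unfold EE
  have hev : ∀ᶠ r : ℝ in 𝓝[<] 1, r ∈ Set.Ioo (0:ℝ) 1 := Ioo_mem_nhdsLT (by norm_num)
  refine tendsto_integral_filter_of_dominated_convergence _
    (Eventually.of_forall fun r => (measurable_EE r).aestronglyMeasurable) ?_
    (integrable_bound ha hb) ?_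
  · filter_upwards [hev] with r hr
    filter_upwards [ae_prod_good ha hb] with z hz
    exact EE_bound hr.1.le hr.2.le hz
  · filter_upwards [ae_prod_good ha hb] with z hz
    have h := (mul_mem hz).1
    have : ContinuousAt (fun r : ℝ => Real.log (1 + r * (tanhHalf z.1 * tanhHalf z.2))) 1 := by
      refine ContinuousAt.log (by fun_prop) ?_
      linarith
    exact this.tendsto.mono_left nhdsWithin_le_nhds

theorem EE_hasSum (a b : Measure EReal) [IsFiniteMeasure a] [IsFiniteMeasure b]
    {r : ℝ} (hr : 0 ≤ r) (hr' : r < 1) :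
    HasSum (fun k : ℕ => -((-r) ^ (k + 1) / (k + 1)) * (mom a (k + 1) * mom b (k + 1)))
      (EE a b r) := by
  set F : ℕ → EReal × EReal → ℝ := fun k z =>
    -((-r) ^ (k + 1) / (k + 1)) * (tanhHalf z.1 ^ (k + 1) * tanhHalf z.2 ^ (k + 1)) with hF
  have hint : ∀ k, Integrable (F k) (a.prod b) := fun k =>
    ((integrable_pow a (k+1)).mul_prod (integrable_pow b (k+1))).const_mul _
  have hle : ∀ k z, ‖F k z‖ ≤ r ^ k := by
    intro k z
    simp only [hF]
    rw [norm_mul, norm_neg, norm_div, norm_pow, norm_neg, norm_mul, norm_pow, norm_pow]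
    simp only [Real.norm_eq_abs]
    rw [abs_of_nonneg hr, abs_of_nonneg (by positivity : (0:ℝ) ≤ k + 1)]
    have h1 : |tanhHalf z.1| ^ (k+1) ≤ 1 := pow_le_one₀ (abs_nonneg _) (abs_tanhHalf_le _)
    have h2 : |tanhHalf z.2| ^ (k+1) ≤ 1 := pow_le_one₀ (abs_nonneg _) (abs_tanhHalf_le _)
    have h3 : r ^ (k+1) / (k+1) ≤ r ^ k := by
      rw [div_le_iff₀ (by positivity), pow_succ]
      have : (0:ℝ) ≤ k := by positivity
      have : 0 ≤ r ^ k := by positivity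
      nlinarith
    calc _ ≤ r ^ k * (1 * 1) := by gcongr
      _ = r ^ k := by ring
  have hsum : Summable fun k => ∫ z, ‖F k z‖ ∂(a.prod b) := by
    refine Summable.of_nonneg_of_le (fun k => integral_nonneg fun z => norm_nonneg _) (fun k => ?_)
      ((summable_geometric_of_lt_one hr hr').mul_right ((a.prod b).real Set.univ))
    have := integral_mono (hint k).norm (integrable_const (r ^ k)) (hle k)
    simpa [mul_comm] using this
  have := hasSum_integral_of_summable_integral_norm hint hsum
  have e1 : (fun k : ℕ => -((-r) ^ (k + 1) / (k + 1)) * (mom a (k + 1) * mom b (k + 1))) =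
      fun k => ∫ z, F k z ∂(a.prod b) := by
    ext k
    simp only [hF]
    rw [integral_const_mul, integral_prod_mul (fun x => tanhHalf x ^ (k + 1))
      (fun x => tanhHalf x ^ (k + 1))]
    rfl
  have e2 : EE a b r = ∫ z, (∑' k, F k z) ∂(a.prod b) := by
    unfold EE
    congr 1
    ext z
    have hs : |tanhHalf z.1 * tanhHalf z.2| ≤ 1 := by
      rw [abs_mul]
      exact mul_le_one₀ (abs_tanhHalf_le _) (abs_nonneg _) (abs_tanhHalf_le _)
    have hx : |-(r * (tanhHalf z.1 * tanhHalf z.2))| < 1 := by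
      rw [abs_neg, abs_mul, abs_of_nonneg hr]
      nlinarith [abs_nonneg (tanhHalf z.1 * tanhHalf z.2)]
    have := (Real.hasSum_pow_div_log_of_abs_lt_one hx).neg.tsum_eq
    rw [neg_neg, sub_neg_eq_add] at this
    rw [← this]
    congr 1
    ext k
    simp only [hF]
    rw [← neg_mul, mul_pow, mul_pow]
    ring
  rw [e1, e2]
  exact this

/-- Lower bound of the regularised form by any single paired term. -/
theorem pair_bound (D : ℕ → ℝ) (hD : ∀ j, D (2 * j + 1) = D (2 * j + 2)) {r F : ℝ}
    (hr : 0 ≤ r) (hr' : r < 1)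
    (h : HasSum (fun k : ℕ => -((-r) ^ (k + 1) / (k + 1)) * D (k + 1) ^ 2) F) (j : ℕ) :
    (r ^ (2 * j + 1) / (2 * j + 1) - r ^ (2 * j + 2) / (2 * j + 2)) * D (2 * j + 2) ^ 2 ≤ F := by
  set f : ℕ → ℝ := fun k : ℕ => -((-r) ^ (k + 1) / (k + 1)) * D (k + 1) ^ 2 with hf
  have he : Summable fun k => f (2 * k) :=
    h.summable.comp_injective (fun a b hab => by simpa using hab)
  have ho : Summable fun k => f (2 * k + 1) :=
    h.summable.comp_injective (i := fun k => 2 * k + 1) (fun a b hab => by simpa using hab)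
  have h1 := tsum_even_add_odd he ho
  rw [← he.tsum_add ho, h.tsum_eq] at h1
  have hterm : ∀ k, f (2 * k) + f (2 * k + 1) =
      (r ^ (2 * k + 1) / (2 * k + 1) - r ^ (2 * k + 2) / (2 * k + 2)) * D (2 * k + 2) ^ 2 := by
    intro k
    simp only [hf]
    rw [hD, Odd.neg_pow ⟨k, rfl⟩, Even.neg_pow ⟨k + 1, by ring⟩]
    push_cast
    ring
  have hnn : ∀ k, 0 ≤ f (2 * k) + f (2 * k + 1) := by
    intro k
    rw [hterm]
    refine mul_nonneg (sub_nonneg.2 ?_) (sq_nonneg _)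
    have : r ^ (2 * k + 2) ≤ r ^ (2 * k + 1) := pow_le_pow_of_le_one hr hr'.le (by omega)
    gcongr
    norm_num
  rw [← hterm, ← h1]
  exact (he.add ho).le_tsum j fun k _ => hnn k

theorem eq_of_mom (a b : Measure EReal) [IsFiniteMeasure a] [IsFiniteMeasure b]
    (h : ∀ k, mom a k = mom b k) : a = b := by
  have hpoly : ∀ q : ℝ[X], ∫ x, q.eval (tanhHalf x) ∂a = ∫ x, q.eval (tanhHalf x) ∂b := by
    intro q
    simp_rw [Polynomial.eval_eq_sum_range]
    rw [integral_finsetSum _ fun k _ => (integrable_pow a k).const_mul _,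
      integral_finsetSum _ fun k _ => (integrable_pow b k).const_mul _]
    refine Finset.sum_congr rfl fun k _ => ?_
    rw [integral_const_mul, integral_const_mul]
    congr 1
    exact h k
  have hpi : ∀ (c : Measure EReal) [IsFiniteMeasure c] (q : ℝ[X]),
      Integrable (fun x => q.eval (tanhHalf x)) c := by
    intro c _ q
    simp_rw [Polynomial.eval_eq_sum_range]
    exact integrable_finsetSum _ fun k _ => (integrable_pow c k).const_mul _
  have hmap : a.map tanhHalf = b.map tanhHalf := by
    refine ext_of_forall_integral_eq_of_IsFiniteMeasure fun f => ?_
    have hfm := f.continuous.measurable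
    rw [integral_map measurable_tanhHalf.aemeasurable hfm.aestronglyMeasurable,
      integral_map measurable_tanhHalf.aemeasurable hfm.aestronglyMeasurable]
    have hfi : ∀ (c : Measure EReal) [IsFiniteMeasure c],
        Integrable (fun x => f (tanhHalf x)) c := by
      intro c _
      exact Integrable.of_bound (C := ‖f‖) (hfm.comp measurable_tanhHalf).aestronglyMeasurable
        (ae_of_all _ fun x => f.norm_coe_le_norm _)
    have key : ∀ ε : ℝ, 0 < ε → |∫ x, f (tanhHalf x) ∂a - ∫ x, f (tanhHalf x) ∂b| ≤
        ε * (a.real Set.univ + b.real Set.univ) := by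
      intro ε hε
      obtain ⟨q, hq⟩ := exists_polynomial_near_of_continuousOn (-1) 1 f f.continuous.continuousOn
        ε hε
      have hc : ∀ (c : Measure EReal) [IsFiniteMeasure c],
          |∫ x, q.eval (tanhHalf x) ∂c - ∫ x, f (tanhHalf x) ∂c| ≤ ε * c.real Set.univ := by
        intro c _
        rw [← integral_sub (hpi c q) (hfi c), ← Real.norm_eq_abs]
        refine norm_integral_le_of_norm_le_const (ae_of_all _ fun x => ?_)
        rw [Real.norm_eq_abs]
        exact (hq _ ⟨neg_one_le_tanhHalf x, tanhHalf_le_one x⟩).le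
      have h1 := abs_le.1 (hc a)
      have h2 := abs_le.1 (hc b)
      rw [hpoly q] at h1
      rw [abs_le]
      constructor <;> linarith [h1.1, h1.2, h2.1, h2.2]
    have h0 : |∫ x, f (tanhHalf x) ∂a - ∫ x, f (tanhHalf x) ∂b| ≤ 0 := by
      have ht : Tendsto (fun ε : ℝ => ε * (a.real Set.univ + b.real Set.univ)) (𝓝[>] 0) (𝓝 0) := by
        have : Tendsto (fun ε : ℝ => ε * (a.real Set.univ + b.real Set.univ)) (𝓝 0)
            (𝓝 (0 * (a.real Set.univ + b.real Set.univ))) := by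
          exact tendsto_id.mul_const _
        rw [zero_mul] at this
        exact this.mono_left nhdsWithin_le_nhds
      refine ge_of_tendsto ht ?_
      filter_upwards [self_mem_nhdsWithin] with ε hε using key ε hε
    exact sub_eq_zero.1 (abs_nonpos_iff.1 h0)
  have hid : ∀ c : Measure EReal, (c.map tanhHalf).map atanhTwo = c := by
    intro c
    rw [Measure.map_map measurable_atanhTwo measurable_tanhHalf]
    have : atanhTwo ∘ tanhHalf = id := funext atanhTwo_tanhHalf
    rw [this, Measure.map_id]
  rw [← hid a, ← hid b, hmap]

theorem measurable_chk : Measurable (fun p : EReal × EReal =>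
    atanhTwo (tanhHalf p.1 * tanhHalf p.2)) := by
  have := measurable_tanhHalf
  exact measurable_atanhTwo.comp (by fun_prop)

theorem entFn_mCheck {a b : Measure EReal} [IsFiniteMeasure a] [IsFiniteMeasure b]
    (ha : Good a) (hb : Good b) : Integrable entFn (mCheck a b) ∧
      ∫ x, entFn x ∂(mCheck a b) = mom a 0 * mom b 0 - EE a b 1 / Real.log 2 := by
  have hi : Integrable (fun z : EReal × EReal =>
      Real.log (1 + 1 * (tanhHalf z.1 * tanhHalf z.2))) (a.prod b) := by
    refine (integrable_bound ha hb).mono' (measurable_EE 1).aestronglyMeasurable ?_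
    filter_upwards [ae_prod_good ha hb] with z hz
    exact EE_bound zero_le_one le_rfl hz
  have hae : (fun z : EReal × EReal => 1 - Real.log (1 + 1 * (tanhHalf z.1 * tanhHalf z.2)) /
      Real.log 2) =ᵐ[a.prod b] fun z => entFn (atanhTwo (tanhHalf z.1 * tanhHalf z.2)) := by
    filter_upwards [ae_prod_good ha hb] with z hz
    rw [entFn_atanhTwo (mul_mem hz).1 (mul_mem hz).2, one_mul]
  have hi2 := (integrable_const (1:ℝ)).sub (hi.div_const (Real.log 2))
  constructor
  · unfold mCheck
    rw [integrable_map_measure measurable_entFn.aestronglyMeasurable measurable_chk.aemeasurable]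
    exact hi2.congr hae
  · unfold mCheck
    rw [integral_map measurable_chk.aemeasurable measurable_entFn.aestronglyMeasurable,
      ← integral_congr_ae hae, integral_sub (integrable_const _) (hi.div_const _),
      integral_div]
    congr 1
    have := integral_prod_mul (μ := a) (ν := b) (fun x => tanhHalf x ^ 0) (fun x => tanhHalf x ^ 0)
    unfold mom
    rw [← this]
    simp

/-- For every `y ∈ X_d`, `H(y ⊠ y) ≤ 0`, with equality iff `y = 0`. -/
theorem entropy_check_self_nonpos (y : SM) (hy : MemXd y) :
    H (sCheck y y) ≤ 0 ∧ (H (sCheck y y) = 0 ↔ y = 0) := by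
  obtain ⟨x1, x2, ⟨⟨μ, hμ, hx1⟩, hs1⟩, ⟨⟨ν, hν, hx2⟩, hs2⟩, hy12⟩ := hy
  have hsμ : IsSymmMeasure μ := by
    have := hs1.1
    rwa [hx1, jp_toSigned] at this
  have hsν : IsSymmMeasure ν := by
    have := hs2.1
    rwa [hx2, jp_toSigned] at this
  have hyeq : y = μ.toSignedMeasure - ν.toSignedMeasure := by rw [hy12, hx1, hx2]
  have gp : Good (jp y) := (good_of_symm μ hsμ).mono (by rw [hyeq, jp_sub]; exact Measure.sub_le)
  have gn : Good (jn y) := (good_of_symm ν hsν).mono (by rw [hyeq, jn_sub]; exact Measure.sub_le)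
  have hmom : ∀ k, mom (jp y) k - mom (jn y) k = mom μ k - mom ν k := by
    intro k
    have h3 : ∫ x, tanhHalf x ^ k ∂(jp y + ν) = ∫ x, tanhHalf x ^ k ∂(jn y + μ) := by
      rw [jp_add μ ν y hyeq]
    rw [integral_add_measure (integrable_pow _ _) (integrable_pow _ _),
      integral_add_measure (integrable_pow _ _) (integrable_pow _ _)] at h3
    unfold mom
    linarith
  set D : ℕ → ℝ := fun k => mom (jp y) k - mom (jn y) k with hDdef
  have hD0 : D 0 = 0 := by
    simp only [hDdef]
    rw [hmom]
    simp [mom]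
  have hD : ∀ j, D (2 * j + 1) = D (2 * j + 2) := by
    intro j
    simp only [hDdef]
    rw [hmom, hmom, mom_symm μ hsμ, mom_symm ν hsν]
  set F : ℝ → ℝ := fun r => EE (jp y) (jp y) r - EE (jp y) (jn y) r - EE (jn y) (jp y) r
    + EE (jn y) (jn y) r with hF
  have hFt : Tendsto F (𝓝[<] 1) (𝓝 (F 1)) :=
    (((EE_tendsto gp gp).sub (EE_tendsto gp gn)).sub (EE_tendsto gn gp)).add (EE_tendsto gn gn)
  have hFs : ∀ r : ℝ, 0 ≤ r → r < 1 →
      HasSum (fun k : ℕ => -((-r) ^ (k + 1) / (k + 1)) * D (k + 1) ^ 2) (F r) := by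
    intro r h0 h1
    have := (((EE_hasSum (jp y) (jp y) h0 h1).sub (EE_hasSum (jp y) (jn y) h0 h1)).sub
      (EE_hasSum (jn y) (jp y) h0 h1)).add (EE_hasSum (jn y) (jn y) h0 h1)
    refine this.congr_fun ?_
    intro k
    simp only [hDdef]
    ring
  have hlow : ∀ j : ℕ, (1 / (2 * j + 1) - 1 / (2 * j + 2)) * D (2 * j + 2) ^ 2 ≤ F 1 := by
    intro j
    have ht : Tendsto (fun r : ℝ => (r ^ (2 * j + 1) / (2 * j + 1) - r ^ (2 * j + 2) / (2 * j + 2))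
        * D (2 * j + 2) ^ 2) (𝓝[<] 1)
        (𝓝 ((1 / (2 * j + 1) - 1 / (2 * j + 2)) * D (2 * j + 2) ^ 2)) := by
      have : Continuous (fun r : ℝ => (r ^ (2 * j + 1) / (2 * j + 1)
          - r ^ (2 * j + 2) / (2 * j + 2)) * D (2 * j + 2) ^ 2) := by fun_prop
      have h := this.tendsto 1
      simp only [one_pow] at h
      exact h.mono_left nhdsWithin_le_nhds
    refine le_of_tendsto_of_tendsto ht hFt ?_
    have hev : ∀ᶠ r : ℝ in 𝓝[<] 1, r ∈ Set.Ioo (0:ℝ) 1 := Ioo_mem_nhdsLT (by norm_num)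
    filter_upwards [hev] with r hr
    exact pair_bound D hD hr.1.le hr.2 (hFs r hr.1.le hr.2) j
  have hpos : ∀ j : ℕ, (0:ℝ) < 1 / (2 * j + 1) - 1 / (2 * j + 2) := by
    intro j
    rw [sub_pos]
    exact one_div_lt_one_div_of_lt (by positivity) (by linarith)
  have hF1 : 0 ≤ F 1 := (mul_nonneg (hpos 0).le (sq_nonneg _)).trans (hlow 0)
  have hl : 0 < Real.log 2 := Real.log_pos (by norm_num)
  have hH : H (sCheck y y) = - (F 1 / Real.log 2) := by
    obtain ⟨i1, e1⟩ := entFn_mCheck gp gp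
    obtain ⟨i2, e2⟩ := entFn_mCheck gp gn
    obtain ⟨i3, e3⟩ := entFn_mCheck gn gp
    obtain ⟨i4, e4⟩ := entFn_mCheck gn gn
    unfold H
    rw [sInt_sub entFn (mCheck (jp y) (jp y) + mCheck (jn y) (jn y))
      (mCheck (jp y) (jn y) + mCheck (jn y) (jp y)) (i1.add_measure i4) (i2.add_measure i3)
      (sCheck y y) (by
        unfold sCheck
        rw [Measure.toSignedMeasure_add, Measure.toSignedMeasure_add]
        abel),
      integral_add_measure i1 i4, integral_add_measure i2 i3, e1, e2, e3, e4]
    have : mom (jp y) 0 = mom (jn y) 0 := sub_eq_zero.1 hD0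
    simp only [hF, this]
    ring
  have hle : H (sCheck y y) ≤ 0 := by
    rw [hH]
    exact neg_nonpos.2 (div_nonneg hF1 hl.le)
  refine ⟨hle, ?_, ?_⟩
  · intro h0
    rw [hH, neg_eq_zero, div_eq_zero_iff, or_iff_left hl.ne'] at h0
    have hDe : ∀ j, D (2 * j + 2) = 0 := by
      intro j
      have h1 := hlow j
      rw [h0] at h1
      have h2 : D (2 * j + 2) ^ 2 ≤ 0 := by
        by_contra hc
        exact absurd (mul_pos (hpos j) (not_le.1 hc)) (not_lt.2 h1)
      exact pow_eq_zero_iff (two_ne_zero) |>.1 (le_antisymm h2 (sq_nonneg _))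
    have hall : ∀ k, mom (jp y) k = mom (jn y) k := by
      intro k
      refine sub_eq_zero.1 (?_ : D k = 0)
      rcases Nat.even_or_odd' k with ⟨m, rfl | rfl⟩
      · cases m with
        | zero => exact hD0
        | succ m => exact hDe m
      · rw [hD]; exact hDe m
    have heq := eq_of_mom _ _ hall
    rw [← jp_sub_jn y, sub_eq_zero]
    exact Measure.toSignedMeasure_congr heq
  · intro h0
    have : jp y = jn y := by
      have h1 := jp_sub_jn y
      rw [h0, sub_eq_zero, Measure.toSignedMeasure_eq_toSignedMeasure_iff] at h1
      rw [h0, h1]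
    rw [hH]
    simp only [hF, this]
    simp

end SCLDPC
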